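/- arXiv:2411.01407 — 3 statements merged into one kernel-verified Lean document; each statement's English description precedes it below -/
import Mathlib

section
/- Let N ≥ 1 and let G_N be the graph on n = 8N+2 vertices x_1,…,x_{8N}, x_a, x_b with edges {x_j,x_{j+1}} for 1 ≤ j ≤ 8N−1, {x_a,x_j} for 1 ≤ j ≤ 6N, {x_b,x_j} for 2N+1 ≤ j ≤ 8N, and {x_a,x_b}. Then the uncoded stretch metric with one redundant chunk satisfies S^u_2(G_N, n+1) = (3N+2)/2. -/
/-- The uncoded stretch metric `S^u_t(G,m)`. -/
noncomputable def uncodedStretch {V : Type*} (G : SimpleGraph V) (t m : ℕ) : ℝ :=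
  sInf { r : ℝ | ∃ s : Fin m → V, Function.Surjective s ∧
    ∀ (u v : V) (p : G.Walk u v), p.IsPath → p.length + 1 ≤ t →
      ∃ a b : ℕ, a ≤ b ∧ b < m ∧
        (∀ x ∈ p.support, ∃ j : Fin m, a ≤ (j : ℕ) ∧ (j : ℕ) ≤ b ∧ s j = x) ∧
        ((b - a + 1 : ℕ) : ℝ) ≤ r * ((p.length : ℝ) + 1) }

/-- The graph `G_N` of Example 5 (Fig. 6), 0-indexed: vertices `0,…,8N−1` are the line
vertices `x_1,…,x_{8N}`, vertex `8N` is `x_a` and vertex `8N+1` is `x_b`; `x_a` is adjacent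
to `x_1,…,x_{6N}`, `x_b` is adjacent to `x_{2N+1},…,x_{8N}`, and `x_a` is adjacent to
`x_b`. -/
def exGraphOne (N : ℕ) : SimpleGraph (Fin (8 * N + 2)) :=
  SimpleGraph.fromRel (fun u v =>
    ((u : ℕ) + 1 = (v : ℕ) ∧ (v : ℕ) < 8 * N) ∨
    ((u : ℕ) = 8 * N ∧ (v : ℕ) < 6 * N) ∨
    ((u : ℕ) = 8 * N + 1 ∧ 2 * N ≤ (v : ℕ) ∧ (v : ℕ) < 8 * N) ∨
    ((u : ℕ) = 8 * N ∧ (v : ℕ) = 8 * N + 1))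

/-- Distance constraint forced on the unique occurrence of a high degree vertex. -/
lemma key_lower (N : ℕ) (r : ℝ) (s : Fin (8 * N + 3) → Fin (8 * N + 2))
    (h : ∀ (u v : Fin (8 * N + 2)) (p : (exGraphOne N).Walk u v), p.IsPath → p.length + 1 ≤ 2 →
      ∃ a b : ℕ, a ≤ b ∧ b < 8 * N + 3 ∧
        (∀ x ∈ p.support, ∃ j : Fin (8 * N + 3), a ≤ (j : ℕ) ∧ (j : ℕ) ≤ b ∧ s j = x) ∧
        ((b - a + 1 : ℕ) : ℝ) ≤ r * ((p.length : ℝ) + 1))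
    (c : Fin (8 * N + 2)) (P : Fin (8 * N + 3)) (hP : s P = c)
    (huniq : ∀ j, s j = c → j = P)
    (f : Fin (6 * N + 2) → Fin (8 * N + 2)) (hf : Function.Injective f)
    (hadj : ∀ i, f i = c ∨ (exGraphOne N).Adj c (f i)) :
    (3 * (N : ℝ) + 2) / 2 ≤ r := by
  by_contra hr
  push Not at hr
  have key : ∀ i, ∃ j : Fin (8 * N + 3), s j = f i ∧ (j : ℕ) + 3 * N ≥ P ∧ (j : ℕ) ≤ P + 3 * N := by
    intro i
    rcases hadj i with hi | hi
    · exact ⟨P, by rw [hi, hP], by omega, by omega⟩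
    · obtain ⟨a, b, hab, hb, hx, hl⟩ := h c (f i) hi.toWalk
        (SimpleGraph.Walk.IsPath.of_adj hi) (by simp)
      obtain ⟨j, hj1, hj2, hj3⟩ := hx (f i) (by simp)
      obtain ⟨k, hk1, hk2, hk3⟩ := hx c (by simp)
      have := huniq k hk3
      subst this
      have h2 : ((b - a + 1 : ℕ) : ℝ) < ((3 * N + 2 : ℕ) : ℝ) := by
        push_cast [SimpleGraph.Walk.length_cons, SimpleGraph.Walk.length_nil] at hl ⊢
        linarith
      have h3 : b - a + 1 < 3 * N + 2 := by exact_mod_cast h2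
      exact ⟨j, hj3, by omega, by omega⟩
  choose g hg1 hg2 hg3 using key
  have hinj : Function.Injective (fun i => (g i : ℕ)) := by
    intro i i' hii
    apply hf
    rw [← hg1, ← hg1, Fin.ext hii]
  have hsub : Finset.univ.image (fun i => (g i : ℕ)) ⊆
      Finset.Icc ((P : ℕ) - 3 * N) (P + 3 * N) := by
    intro x hx
    simp only [Finset.mem_image, Finset.mem_univ, true_and] at hx
    obtain ⟨i, rfl⟩ := hx
    have := hg2 i
    have := hg3 i
    simp only [Finset.mem_Icc]
    omega
  have hc := Finset.card_le_card hsub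
  rw [Finset.card_image_of_injective _ hinj] at hc
  simp at hc
  omega

/-- The optimal ordering, with one useless extra chunk at the end. -/
def optStore (N : ℕ) (i : Fin (8 * N + 3)) : Fin (8 * N + 2) :=
  ⟨if (i : ℕ) < 3 * N then i else if (i : ℕ) = 3 * N then 8 * N else
    if (i : ℕ) < 5 * N + 1 then i - 1 else if (i : ℕ) = 5 * N + 1 then 8 * N + 1 else
    i - 2, by split_ifs <;> omega⟩

/-- Position of a vertex in the optimal ordering. -/
def optPos (N : ℕ) (v : Fin (8 * N + 2)) : Fin (8 * N + 3) :=
  ⟨if (v : ℕ) < 3 * N then v else if (v : ℕ) < 5 * N then v + 1 else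
    if (v : ℕ) < 8 * N then v + 2 else if (v : ℕ) = 8 * N then 3 * N else 5 * N + 1,
    by split_ifs <;> omega⟩

lemma optStore_optPos (N : ℕ) (v : Fin (8 * N + 2)) : optStore N (optPos N v) = v := by
  apply Fin.ext
  simp only [optStore, optPos]
  split_ifs <;> omega

lemma optPos_adj (N : ℕ) (hN : 1 ≤ N) (u v : Fin (8 * N + 2)) (h : (exGraphOne N).Adj u v) :
    (optPos N u : ℕ) ≤ optPos N v + (3 * N + 1) ∧ (optPos N v : ℕ) ≤ optPos N u + (3 * N + 1) := by
  simp only [exGraphOne, SimpleGraph.fromRel_adj] at h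
  simp only [optPos]
  obtain ⟨-, h⟩ := h
  split_ifs <;> omega

theorem statement_16 (N : ℕ) (hN : 1 ≤ N) :
    uncodedStretch (exGraphOne N) 2 (8 * N + 3) = (3 * (N : ℝ) + 2) / 2 := by
  have hN' : (1 : ℝ) ≤ N := by exact_mod_cast hN
  apply IsLeast.csInf_eq
  refine ⟨⟨optStore N, fun v => ⟨optPos N v, optStore_optPos N v⟩, ?_⟩, ?_⟩
  · intro u v p hp hl
    cases p with
    | nil =>
      refine ⟨optPos N u, optPos N u, le_rfl, (optPos N u).2, ?_, ?_⟩
      · intro x hx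
        simp at hx
        subst hx
        exact ⟨optPos N x, le_rfl, le_rfl, optStore_optPos N x⟩
      · simp
        linarith
    | cons hadj q =>
      cases q with
      | cons h2 q => simp at hl
      | nil =>
        obtain ⟨h1, h2⟩ := optPos_adj N hN _ _ hadj
        refine ⟨min (optPos N u) (optPos N v), max (optPos N u) (optPos N v), ?_, ?_, ?_, ?_⟩
        · omega
        · omega
        · intro x hx
          refine ⟨optPos N x, ?_, ?_, optStore_optPos N x⟩
          all_goals
            simp at hx
            rcases hx with rfl | rfl <;> omega
        · have : max (optPos N u : ℕ) (optPos N v) - min (optPos N u : ℕ) (optPos N v) + 1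
              ≤ 3 * N + 2 := by omega
          have h3 : ((max (optPos N u : ℕ) (optPos N v) - min (optPos N u : ℕ) (optPos N v) + 1 : ℕ) : ℝ)
              ≤ ((3 * N + 2 : ℕ) : ℝ) := by exact_mod_cast this
          refine h3.trans ?_
          simp
          linarith
  · rintro r ⟨s, hs, h⟩
    let va : Fin (8 * N + 2) := ⟨8 * N, by omega⟩
    let vb : Fin (8 * N + 2) := ⟨8 * N + 1, by omega⟩
    obtain ⟨A, hA⟩ := hs va
    obtain ⟨B, hB⟩ := hs vb
    by_cases ha : ∀ j, s j = va → j = A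
    · refine key_lower N r s h va A hA ha
        (fun i => ⟨if (i : ℕ) < 6 * N then i else i + 2 * N, by split_ifs <;> omega⟩) ?_ ?_
      · intro i i' hii
        simp only [Fin.mk.injEq] at hii
        apply Fin.ext
        split_ifs at hii <;> omega
      · intro i
        simp only [exGraphOne, SimpleGraph.fromRel_adj, Fin.ext_iff, ne_eq, true_and, and_true, va]
        split_ifs <;> omega
    by_cases hb : ∀ j, s j = vb → j = B
    · refine key_lower N r s h vb B hB hb (fun i => ⟨i + 2 * N, by omega⟩) ?_ ?_
      · intro i i' hii
        simp only [Fin.mk.injEq] at hii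
        apply Fin.ext
        omega
      · intro i
        simp only [exGraphOne, SimpleGraph.fromRel_adj, Fin.ext_iff, ne_eq, true_and, and_true, vb]
        omega
    exfalso
    push Not at ha hb
    obtain ⟨A', hA', hAA⟩ := ha
    obtain ⟨B', hB', hBB⟩ := hb
    have hab : va ≠ vb := by simp [va, vb]
    have hne : A ≠ B := by
      rintro rfl
      exact hab (hA.symm.trans hB)
    have hsub : (Finset.univ : Finset (Fin (8 * N + 2))) ⊆
        (({A, B} : Finset (Fin (8 * N + 3)))ᶜ).image s := by
      intro v _
      simp only [Finset.mem_image, Finset.mem_compl, Finset.mem_insert, Finset.mem_singleton, not_or]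
      by_cases h1 : v = va
      · refine ⟨A', ⟨hAA, ?_⟩, hA'.trans h1.symm⟩
        rintro rfl
        exact hab (hA'.symm.trans hB)
      by_cases h2 : v = vb
      · refine ⟨B', ⟨?_, hBB⟩, hB'.trans h2.symm⟩
        rintro rfl
        exact hab (hA.symm.trans hB')
      obtain ⟨j, hj⟩ := hs v
      refine ⟨j, ⟨?_, ?_⟩, hj⟩
      · rintro rfl
        exact h1 (hj.symm.trans hA)
      · rintro rfl
        exact h2 (hj.symm.trans hB)
    have hc := (Finset.card_le_card hsub).trans Finset.card_image_le
    rw [Finset.card_compl, Finset.card_pair hne] at hc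
    simp at hc
end

section
/- Let N ≥ 1 and let G_N be the graph on n = 8N+2 vertices x_1,…,x_{8N}, x_a, x_b with edges {x_j,x_{j+1}} for 1 ≤ j ≤ 8N−1, {x_a,x_j} for 1 ≤ j ≤ 6N, {x_b,x_j} for 2N+1 ≤ j ≤ 8N, and {x_a,x_b}. Then the linearly coded stretch metric with one redundant chunk satisfies S^c_2(G_N, n+1) ≤ (2N+2)/2 = N+1 (witnessed by the store x_1,…,x_{2N}, x_a, x_{2N+1},…,x_{4N}, x_a⊕x_b, x_{4N+1},…,x_{6N}, x_b, x_{6N+1},…,x_{8N}). -/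
/-- The linear map of a linearly coded chunk store: position `j` stores `⊕_{i ∈ A j} x i`. -/
def linMap {n m : ℕ} (A : Fin m → Finset (Fin n)) (x : Fin n → ZMod 2) : Fin m → ZMod 2 :=
  fun j => ∑ i ∈ A j, x i

/-- `A` is a linearly coded chunk store: the map `(x_1,…,x_n) ↦ (s_1,…,s_m)` is injective. -/
def IsLinStore {n m : ℕ} (A : Fin m → Finset (Fin n)) : Prop :=
  Function.Injective (linMap A)

/-- Coordinate `i` is recoverable from the interval `[a,b]` of positions of the linearly
coded store `A`. -/
def LinRecovers {n m : ℕ} (A : Fin m → Finset (Fin n)) (a b : ℕ) (i : Fin n) : Prop :=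
  ∃ D : Finset (Fin m), (∀ j ∈ D, a ≤ (j : ℕ) ∧ (j : ℕ) ≤ b) ∧
    ∀ i' : Fin n, (∑ j ∈ D, if i' ∈ A j then (1 : ZMod 2) else 0) = if i' = i then 1 else 0

/-- The linearly coded stretch metric `S^c_t(G,m)`. -/
noncomputable def linStretch {n : ℕ} (G : SimpleGraph (Fin n)) (t m : ℕ) : ℝ :=
  sInf { r : ℝ | ∃ A : Fin m → Finset (Fin n), IsLinStore A ∧
    ∀ (u v : Fin n) (p : G.Walk u v), p.IsPath → p.length + 1 ≤ t →
      ∃ a b : ℕ, a ≤ b ∧ b < m ∧ (∀ i ∈ p.support, LinRecovers A a b i) ∧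
        ((b - a + 1 : ℕ) : ℝ) ≤ r * ((p.length : ℝ) + 1) }

/-- Membership relation of the witnessing store. -/
def exCode (N j i : ℕ) : Prop :=
  (j < 2 * N ∧ i = j) ∨ (j = 2 * N ∧ i = 8 * N) ∨ (2 * N < j ∧ j ≤ 4 * N ∧ i + 1 = j) ∨
  (j = 4 * N + 1 ∧ (i = 8 * N ∨ i = 8 * N + 1)) ∨
  (4 * N + 2 ≤ j ∧ j ≤ 6 * N + 1 ∧ i + 2 = j) ∨ (j = 6 * N + 2 ∧ i = 8 * N + 1) ∨
  (6 * N + 3 ≤ j ∧ i + 3 = j)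

open Classical in
/-- The witnessing store. -/
noncomputable def exStore (N : ℕ) (j : Fin (8 * N + 3)) : Finset (Fin (8 * N + 2)) :=
  Finset.univ.filter (fun i => exCode N j i)

lemma mem_exStore (N : ℕ) (j : Fin (8 * N + 3)) (i : Fin (8 * N + 2)) :
    i ∈ exStore N j ↔ exCode N j i := by
  simp [exStore]

lemma rec_one (N a b j : ℕ) (i : Fin (8 * N + 2)) (hj : j < 8 * N + 3) (ha : a ≤ j) (hb : j ≤ b)
    (h : ∀ k, k < 8 * N + 2 → (exCode N j k ↔ k = i)) : LinRecovers (exStore N) a b i := by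
  refine ⟨{⟨j, hj⟩}, by simp [ha, hb], fun i' => ?_⟩
  have := h i' i'.2
  simp only [Finset.sum_singleton, mem_exStore, this, Fin.ext_iff]

lemma rec_two (N a b j l : ℕ) (i : Fin (8 * N + 2)) (hjl : j < l) (hl : l < 8 * N + 3)
    (ha : a ≤ j) (hb : l ≤ b)
    (h : ∀ k, k < 8 * N + 2 → ((¬ (exCode N j k ↔ exCode N l k)) ↔ k = i)) :
    LinRecovers (exStore N) a b i := by
  refine ⟨{⟨j, by omega⟩, ⟨l, hl⟩}, ?_, fun i' => ?_⟩
  · intro x hx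
    simp only [Finset.mem_insert, Finset.mem_singleton] at hx
    rcases hx with rfl | rfl <;> simp <;> omega
  · have := h i' i'.2
    have hne : (⟨j, by omega⟩ : Fin (8 * N + 3)) ≠ ⟨l, hl⟩ := by
      intro h0
      have := congrArg Fin.val h0
      simp only at this
      omega
    have hi : i' = i ↔ ¬ (exCode N j i' ↔ exCode N l i') := by rw [this, Fin.ext_iff]
    rw [Finset.sum_pair hne]
    have m1 := mem_exStore N ⟨j, by omega⟩ i'
    have m2 := mem_exStore N ⟨l, hl⟩ i'
    by_cases h1 : exCode N j i' <;> by_cases h2 : exCode N l i' <;>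
      simp only [h1, h2, iff_true, iff_false, true_iff, false_iff, not_true, not_false_eq_true]
        at m1 m2 hi <;> simp only [m1, m2] <;> simp [hi]
    exact CharTwo.add_self_eq_zero 1

/-- Position at which a vertex is stored directly. -/
def exPos (N i : ℕ) : ℕ :=
  if i < 2 * N then i else if i < 4 * N then i + 1 else if i < 6 * N then i + 2
  else if i < 8 * N then i + 3 else if i = 8 * N then 2 * N else 6 * N + 2

lemma exPos_lt (N i : ℕ) : exPos N i < 8 * N + 3 := by
  unfold exPos; split_ifs <;> omega

lemma exCode_exPos (N i : ℕ) (hi : i < 8 * N + 2) (k : ℕ) (hk : k < 8 * N + 2) :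
    exCode N (exPos N i) k ↔ k = i := by
  unfold exPos exCode; split_ifs <;> omega

lemma rec_pos (N a b : ℕ) (i : Fin (8 * N + 2)) (ha : a ≤ exPos N i) (hb : exPos N i ≤ b) :
    LinRecovers (exStore N) a b i :=
  rec_one N a b _ i (exPos_lt N i) ha hb (exCode_exPos N i i.2)

lemma exStore_lin (N : ℕ) : IsLinStore (exStore N) := by
  intro x y h
  funext i
  have h1 := congrFun h ⟨exPos N i, exPos_lt N i⟩
  have h2 : exStore N ⟨exPos N i, exPos_lt N i⟩ = {i} := by
    ext k
    rw [mem_exStore, exCode_exPos N i i.2 k k.2, Finset.mem_singleton, Fin.ext_iff]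
  simpa [linMap, h2] using h1

/-- Both endpoints recoverable from a window of length at most `2N+2`. -/
def Good (N : ℕ) (u v : Fin (8 * N + 2)) : Prop :=
  ∃ a b : ℕ, a ≤ b ∧ b < 8 * N + 3 ∧ LinRecovers (exStore N) a b u ∧
    LinRecovers (exStore N) a b v ∧ b - a + 1 ≤ 2 * N + 2

lemma Good.symm' {N : ℕ} {u v : Fin (8 * N + 2)} (h : Good N u v) : Good N v u := by
  obtain ⟨a, b, h1, h2, h3, h4, h5⟩ := h
  exact ⟨a, b, h1, h2, h4, h3, h5⟩

/-- Window given by the positions. -/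
lemma good_pos (N : ℕ) (u v : Fin (8 * N + 2)) (h1 : exPos N u ≤ exPos N v + (2 * N + 1))
    (h2 : exPos N v ≤ exPos N u + (2 * N + 1)) : Good N u v := by
  have := exPos_lt N u
  have := exPos_lt N v
  refine ⟨min (exPos N u) (exPos N v), max (exPos N u) (exPos N v), by omega, by omega,
    rec_pos _ _ _ _ (by omega) (by omega), rec_pos _ _ _ _ (by omega) (by omega), by omega⟩

lemma good_rel (N : ℕ) (hN : 1 ≤ N) (u v : Fin (8 * N + 2))
    (h : ((u : ℕ) + 1 = (v : ℕ) ∧ (v : ℕ) < 8 * N) ∨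
    ((u : ℕ) = 8 * N ∧ (v : ℕ) < 6 * N) ∨
    ((u : ℕ) = 8 * N + 1 ∧ 2 * N ≤ (v : ℕ) ∧ (v : ℕ) < 8 * N) ∨
    ((u : ℕ) = 8 * N ∧ (v : ℕ) = 8 * N + 1)) : Good N u v := by
  have recb : ∀ w : Fin (8 * N + 2), (w : ℕ) = 8 * N + 1 →
      LinRecovers (exStore N) (2 * N) (4 * N + 1) w := fun w hw =>
    rec_two N _ _ (2 * N) (4 * N + 1) w (by omega) (by omega) (by omega) (by omega)
      (by intro k hk; unfold exCode; omega)
  have reca : ∀ w : Fin (8 * N + 2), (w : ℕ) = 8 * N →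
      LinRecovers (exStore N) (4 * N + 1) (6 * N + 2) w := fun w hw =>
    rec_two N _ _ (4 * N + 1) (6 * N + 2) w (by omega) (by omega) (by omega) (by omega)
      (by intro k hk; unfold exCode; omega)
  rcases h with ⟨h1, h2⟩ | ⟨h1, h2⟩ | ⟨h1, h2, h3⟩ | ⟨h1, h2⟩
  · apply good_pos <;> unfold exPos <;> split_ifs <;> omega
  · by_cases h4 : (v : ℕ) < 4 * N
    · apply good_pos <;> unfold exPos <;> split_ifs <;> omega
    · refine ⟨4 * N + 1, 6 * N + 2, by omega, by omega, reca u h1, rec_pos _ _ _ _ ?_ ?_, by omega⟩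
        <;> unfold exPos <;> split_ifs <;> omega
  · by_cases h4 : (v : ℕ) < 4 * N
    · refine ⟨2 * N, 4 * N + 1, by omega, by omega, recb u h1, rec_pos _ _ _ _ ?_ ?_, by omega⟩
        <;> unfold exPos <;> split_ifs <;> omega
    · apply good_pos <;> unfold exPos <;> split_ifs <;> omega
  · refine ⟨2 * N, 4 * N + 1, by omega, by omega, rec_pos _ _ _ _ ?_ ?_, recb v h2, by omega⟩
      <;> unfold exPos <;> split_ifs <;> omega

/-- For the graph `G_N` on `n = 8N+2` vertices, the linearly coded stretch
metric with one redundant chunk satisfies `S^c_2(G_N, n+1) ≤ (2N+2)/2 = N+1` (witnessed by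
the store `x_1,…,x_{2N}, x_a, x_{2N+1},…,x_{4N}, x_a⊕x_b, x_{4N+1},…,x_{6N}, x_b,
x_{6N+1},…,x_{8N}`). -/
theorem statement_17 (N : ℕ) (hN : 1 ≤ N) :
    linStretch (exGraphOne N) 2 (8 * N + 3) ≤ (2 * (N : ℝ) + 2) / 2 := by
  unfold linStretch
  apply csInf_le
  · refine ⟨0, ?_⟩
    rintro r ⟨A, -, h⟩
    obtain ⟨a, b, -, -, -, h5⟩ := h 0 0 SimpleGraph.Walk.nil (by simp) (by simp)
    simp only [SimpleGraph.Walk.length_nil, Nat.cast_zero, zero_add, mul_one] at h5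
    exact le_trans (Nat.cast_nonneg _) h5
  · refine ⟨exStore N, exStore_lin N, ?_⟩
    intro u v p hp hlen
    cases p with
    | nil =>
      refine ⟨exPos N u, exPos N u, le_rfl, exPos_lt N u, ?_, ?_⟩
      · intro i hi
        simp only [SimpleGraph.Walk.support_nil, List.mem_singleton] at hi
        subst hi
        exact rec_pos _ _ _ _ le_rfl le_rfl
      · simp
        have : (0 : ℝ) ≤ N := Nat.cast_nonneg _
        linarith
    | cons hadj q =>
      cases q with
      | cons h' q' => simp at hlen
      | nil =>
        have hg : Good N u v := by
          rw [exGraphOne, SimpleGraph.fromRel_adj] at hadj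
          rcases hadj.2 with h | h
          · exact good_rel N hN _ _ h
          · exact (good_rel N hN _ _ h).symm'
        obtain ⟨a, b, h1, h2, h3, h4, h5⟩ := hg
        refine ⟨a, b, h1, h2, ?_, ?_⟩
        · intro i hi
          simp only [SimpleGraph.Walk.support_cons, SimpleGraph.Walk.support_nil,
            List.mem_cons, List.not_mem_nil, or_false] at hi
          rcases hi with rfl | rfl
          · exact h3
          · exact h4
        · have h6 : ((b - a + 1 : ℕ) : ℝ) ≤ ((2 * N + 2 : ℕ) : ℝ) := Nat.cast_le.mpr h5
          refine h6.trans (le_of_eq ?_)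
          simp only [SimpleGraph.Walk.length_cons, SimpleGraph.Walk.length_nil]
          push_cast
          ring
end

section
/- Let N ≥ 1 and let H_N be the graph on n = 6N vertices x_1,…,x_{5N}, b_1,…,b_N with edges {x_j,x_{j+1}} for 1 ≤ j ≤ 5N−1, {b_i,x_j} for 2i−1 ≤ j ≤ 3N+2i (for each i ∈ {1,…,N}), and {b_i,b_j} for all i ≠ j. Then the uncoded stretch metric with N−1 redundant chunks satisfies S^u_2(H_N, n+N−1) > (2N+1)/2, while the linearly coded stretch metric with a single redundant chunk satisfies S^c_2(H_N, n+1) ≤ (2N+1)/2. Hence uncoded stores need at least N redundant chunks to match a coded store with one redundant chunk. -/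
/-- The graph `H_N` of Example 6 (Fig. 7), 0-indexed: vertices `0,…,5N−1` are the line
vertices `x_1,…,x_{5N}`; vertex `5N + (i−1)` is `b_i` for `i = 1,…,N`; `b_i` is adjacent to
`x_j` for `2i−1 ≤ j ≤ 3N+2i` (1-indexed), and the `b_i` form a clique. -/
def exGraphTwo (N : ℕ) : SimpleGraph (Fin (6 * N)) :=
  SimpleGraph.fromRel (fun u v =>
    ((u : ℕ) + 1 = (v : ℕ) ∧ (v : ℕ) < 5 * N) ∨
    (∃ i : ℕ, 1 ≤ i ∧ i ≤ N ∧ (u : ℕ) = 5 * N + i - 1 ∧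
      2 * i - 2 ≤ (v : ℕ) ∧ (v : ℕ) + 1 ≤ 3 * N + 2 * i ∧ (v : ℕ) < 5 * N) ∨
    (5 * N ≤ (u : ℕ) ∧ 5 * N ≤ (v : ℕ)))

/-- Position of the line vertex `j` in the coded store. -/
def posX (N j : ℕ) : ℕ := if j < 2 * N then j else if j < 3 * N then 2 * j + 1 - 2 * N else j + N + 1

/-- Membership of vertex `v` in the chunk at position `p`. -/
def memC (N p v : ℕ) : Prop :=
  (v < 5 * N ∧ p = posX N v) ∨
    (5 * N ≤ v ∧ (p + 8 * N = 2 * v ∨ p + 8 * N = 2 * v + 2))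

open Classical in
/-- The coded store. -/
noncomputable def storeA (N : ℕ) : Fin (6 * N + 1) → Finset (Fin (6 * N)) :=
  fun p => Finset.univ.filter (fun v => memC N p v)

theorem mem_storeA (N : ℕ) (p : Fin (6 * N + 1)) (v : Fin (6 * N)) :
    v ∈ storeA N p ↔ memC N p v := by
  classical
  unfold storeA
  rw [Finset.mem_filter]
  simp

theorem posX_lt (N j : ℕ) (hj : j < 5 * N) : posX N j < 6 * N + 1 := by
  unfold posX; split_ifs <;> omega

theorem recX (N a b : ℕ) (v : Fin (6 * N)) (hv : (v : ℕ) < 5 * N)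
    (ha : a ≤ posX N v) (hb : posX N v ≤ b) : LinRecovers (storeA N) a b v := by
  classical
  refine ⟨{⟨posX N v, posX_lt N v hv⟩}, ?_, ?_⟩
  · intro j hj
    rw [Finset.mem_singleton] at hj
    subst hj
    exact ⟨ha, hb⟩
  · intro i'
    rw [Finset.sum_singleton]
    have : i' ∈ storeA N ⟨posX N v, posX_lt N v hv⟩ ↔ i' = v := by
      simp only [mem_storeA, memC, Fin.ext_iff]
      have := i'.2
      unfold posX
      split_ifs <;> omega
    simp only [this]

theorem sum_hub (N : ℕ) (D : Finset (Fin (6 * N + 1))) (i' : Fin (6 * N)) (hi : 5 * N ≤ (i' : ℕ)) :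
    (∑ j ∈ D, if i' ∈ storeA N j then (1 : ZMod 2) else 0) =
      (if (⟨2 * i' - 8 * N, by omega⟩ : Fin (6 * N + 1)) ∈ D then 1 else 0) +
      (if (⟨2 * i' + 2 - 8 * N, by omega⟩ : Fin (6 * N + 1)) ∈ D then 1 else 0) := by
  classical
  rw [← Finset.sum_ite_eq' D _ (fun _ => (1 : ZMod 2)), ← Finset.sum_ite_eq' D _ (fun _ => (1 : ZMod 2)),
    ← Finset.sum_add_distrib]
  refine Finset.sum_congr rfl fun j _ => ?_
  simp only [mem_storeA, memC, Fin.ext_iff]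
  split_ifs <;> first | omega | simp

theorem sum_line (N : ℕ) (D : Finset (Fin (6 * N + 1))) (i' : Fin (6 * N)) (hi : (i' : ℕ) < 5 * N)
    (hD : ∀ j ∈ D, 2 * N ≤ (j : ℕ) ∧ (j : ℕ) ≤ 4 * N ∧ (j : ℕ) % 2 = 0) :
    (∑ j ∈ D, if i' ∈ storeA N j then (1 : ZMod 2) else 0) = 0 := by
  classical
  refine Finset.sum_eq_zero fun j hj => ?_
  have := hD j hj
  rw [if_neg]
  simp only [mem_storeA, memC]
  unfold posX
  split_ifs <;> omega

theorem recBL (N a b : ℕ) (v : Fin (6 * N)) (hv : 5 * N ≤ (v : ℕ))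
    (ha : a ≤ 2 * N) (hb : 2 * (v : ℕ) ≤ b + 8 * N) : LinRecovers (storeA N) a b v := by
  classical
  refine ⟨Finset.univ.filter
    (fun j => 2 * N ≤ (j : ℕ) ∧ (j : ℕ) + 8 * N ≤ 2 * v ∧ (j : ℕ) % 2 = 0), ?_, ?_⟩
  · intro j hj
    simp only [Finset.mem_filter, Finset.mem_univ, true_and] at hj
    omega
  · intro i'
    have h1 := i'.2
    have h2 := v.2
    by_cases hi : 5 * N ≤ (i' : ℕ)
    · rw [sum_hub _ _ _ hi]
      simp only [Finset.mem_filter, Finset.mem_univ, true_and, Fin.ext_iff]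
      split_ifs <;> first | omega | simp | decide
    · rw [sum_line _ _ _ (by omega), if_neg]
      · rintro rfl; exact hi hv
      · intro j hj
        simp only [Finset.mem_filter, Finset.mem_univ, true_and] at hj
        omega

theorem recBR (N a b : ℕ) (v : Fin (6 * N)) (hv : 5 * N ≤ (v : ℕ))
    (ha : a + 8 * N ≤ 2 * v + 2) (hb : 4 * N ≤ b) : LinRecovers (storeA N) a b v := by
  classical
  refine ⟨Finset.univ.filter
    (fun j => (j : ℕ) ≤ 4 * N ∧ 2 * v + 2 ≤ (j : ℕ) + 8 * N ∧ (j : ℕ) % 2 = 0), ?_, ?_⟩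
  · intro j hj
    simp only [Finset.mem_filter, Finset.mem_univ, true_and] at hj
    omega
  · intro i'
    have h1 := i'.2
    have h2 := v.2
    by_cases hi : 5 * N ≤ (i' : ℕ)
    · rw [sum_hub _ _ _ hi]
      simp only [Finset.mem_filter, Finset.mem_univ, true_and, Fin.ext_iff]
      split_ifs <;> first | omega | simp | decide
    · rw [sum_line _ _ _ (by omega), if_neg]
      · rintro rfl; exact hi hv
      · intro j hj
        simp only [Finset.mem_filter, Finset.mem_univ, true_and] at hj
        omega

theorem single_win (N : ℕ) (u : Fin (6 * N)) :
    ∃ a b : ℕ, a ≤ b ∧ b < 6 * N + 1 ∧ b - a + 1 ≤ N ∧ LinRecovers (storeA N) a b u := by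
  have h2 := u.2
  by_cases hu : (u : ℕ) < 5 * N
  · exact ⟨posX N u, posX N u, le_rfl, posX_lt N u hu, by omega, recX N _ _ u hu le_rfl le_rfl⟩
  · by_cases h : 2 * (u : ℕ) - 10 * N + 1 ≤ N
    · exact ⟨2 * N, 2 * u - 8 * N, by omega, by omega, by omega,
        recBL N _ _ u (by omega) (by omega) (by omega)⟩
    · exact ⟨2 * u + 2 - 8 * N, 4 * N, by omega, by omega, by omega,
        recBR N _ _ u (by omega) (by omega) (by omega)⟩

theorem bx_win (N : ℕ) (u v : Fin (6 * N)) (hu : 5 * N ≤ (u : ℕ)) (hv : (v : ℕ) < 5 * N)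
    (h1 : 2 * (u : ℕ) ≤ v + 10 * N) (h2 : (v : ℕ) + 7 * N ≤ 2 * u + 1) :
    ∃ a b : ℕ, a ≤ b ∧ b < 6 * N + 1 ∧ b - a + 1 ≤ 2 * N + 1 ∧
      LinRecovers (storeA N) a b u ∧ LinRecovers (storeA N) a b v := by
  have hu2 := u.2
  have hp := posX_lt N v hv
  have e1 : 2 * (u : ℕ) ≤ posX N v + 10 * N := by unfold posX; split_ifs <;> omega
  have e2 : posX N v + 6 * N ≤ 2 * u + 2 := by unfold posX; split_ifs <;> omega
  by_cases h : posX N v ≤ 4 * N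
  · exact ⟨min (posX N v) (2 * N), max (posX N v) (2 * u - 8 * N), by omega, by omega, by omega,
      recBL N _ _ u hu (by omega) (by omega), recX N _ _ v hv (by omega) (by omega)⟩
  · exact ⟨2 * u + 2 - 8 * N, posX N v, by omega, by omega, by omega,
      recBR N _ _ u hu (by omega) (by omega), recX N _ _ v hv (by omega) (by omega)⟩

theorem pair_win (N : ℕ) (u v : Fin (6 * N)) (h : (exGraphTwo N).Adj u v) :
    ∃ a b : ℕ, a ≤ b ∧ b < 6 * N + 1 ∧ b - a + 1 ≤ 2 * N + 1 ∧
      LinRecovers (storeA N) a b u ∧ LinRecovers (storeA N) a b v := by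
  have key : ∀ u v : Fin (6 * N), (((u : ℕ) + 1 = (v : ℕ) ∧ (v : ℕ) < 5 * N) ∨
    (∃ i : ℕ, 1 ≤ i ∧ i ≤ N ∧ (u : ℕ) = 5 * N + i - 1 ∧
      2 * i - 2 ≤ (v : ℕ) ∧ (v : ℕ) + 1 ≤ 3 * N + 2 * i ∧ (v : ℕ) < 5 * N) ∨
    (5 * N ≤ (u : ℕ) ∧ 5 * N ≤ (v : ℕ))) → ∃ a b : ℕ, a ≤ b ∧ b < 6 * N + 1 ∧ b - a + 1 ≤ 2 * N + 1 ∧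
      LinRecovers (storeA N) a b u ∧ LinRecovers (storeA N) a b v := by
    clear h u v
    intro u v h
    have hu2 := u.2
    have hv2 := v.2
    rcases h with ⟨h1, h2⟩ | ⟨i, h1, h2, h3, h4, h5, h6⟩ | ⟨h1, h2⟩
    · have e : posX N u ≤ posX N v ∧ posX N v ≤ posX N u + 2 := by
        unfold posX; split_ifs <;> omega
      exact ⟨posX N u, posX N v, e.1, posX_lt N v h2, by omega,
        recX N _ _ u (by omega) le_rfl e.1, recX N _ _ v h2 e.1 le_rfl⟩
    · exact bx_win N u v (by omega) h6 (by omega) (by omega)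
    · exact ⟨2 * N, 4 * N, by omega, by omega, by omega,
        recBL N _ _ u h1 (by omega) (by omega), recBL N _ _ v h2 (by omega) (by omega)⟩
  rw [exGraphTwo, SimpleGraph.fromRel_adj] at h
  rcases h.2 with h | h
  · exact key u v h
  · obtain ⟨a, b, h1, h2, h3, h4, h5⟩ := key v u h
    exact ⟨a, b, h1, h2, h3, h5, h4⟩

theorem rec_eq {n m : ℕ} (A : Fin m → Finset (Fin n)) (D : Finset (Fin m)) (i : Fin n)
    (h : ∀ i' : Fin n, (∑ j ∈ D, if i' ∈ A j then (1 : ZMod 2) else 0) = if i' = i then 1 else 0)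
    (x : Fin n → ZMod 2) : ∑ j ∈ D, linMap A x j = x i := by
  classical
  have : ∀ j, linMap A x j = ∑ i', (if i' ∈ A j then (1 : ZMod 2) else 0) * x i' := by
    intro j
    simp [linMap, Finset.sum_ite_mem]
  simp_rw [this]
  rw [Finset.sum_comm]
  simp_rw [← Finset.sum_mul, h]
  simp

theorem storeA_lin (N : ℕ) : IsLinStore (storeA N) := by
  intro x y hxy
  funext i
  obtain ⟨a, b, -, -, -, D, -, hD⟩ := single_win N i
  rw [← rec_eq _ D i hD x, ← rec_eq _ D i hD y, hxy]

theorem coded_part (N : ℕ) (hN : 1 ≤ N) :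
    linStretch (exGraphTwo N) 2 (6 * N + 1) ≤ (2 * (N : ℝ) + 1) / 2 := by
  unfold linStretch
  apply csInf_le
  · refine ⟨0, ?_⟩
    rintro r ⟨A, -, h⟩
    obtain ⟨a, b, -, -, -, h⟩ := h ⟨0, by omega⟩ ⟨0, by omega⟩ SimpleGraph.Walk.nil
      SimpleGraph.Walk.IsPath.nil (by simp)
    simp only [SimpleGraph.Walk.length_nil, Nat.cast_zero, zero_add, mul_one] at h
    exact le_trans (Nat.cast_nonneg _) h
  · refine ⟨storeA N, storeA_lin N, ?_⟩
    intro u v p _ hp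
    cases p with
    | nil =>
      obtain ⟨a, b, h1, h2, h3, h4⟩ := single_win N u
      refine ⟨a, b, h1, h2, ?_, ?_⟩
      · intro i hi
        simp only [SimpleGraph.Walk.support_nil, List.mem_singleton] at hi
        subst hi; exact h4
      · have : ((b - a + 1 : ℕ) : ℝ) ≤ N := by exact_mod_cast h3
        simp only [SimpleGraph.Walk.length_nil, Nat.cast_zero]
        linarith
    | cons h q =>
      cases q with
      | nil =>
        obtain ⟨a, b, h1, h2, h3, h4, h5⟩ := pair_win N _ _ h
        refine ⟨a, b, h1, h2, ?_, ?_⟩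
        · intro i hi
          simp only [SimpleGraph.Walk.support_cons, SimpleGraph.Walk.support_nil,
            List.mem_cons, List.not_mem_nil, or_false] at hi
          rcases hi with rfl | rfl
          · exact h4
          · exact h5
        · have : ((b - a + 1 : ℕ) : ℝ) ≤ ((2 * N + 1 : ℕ) : ℝ) := by exact_mod_cast h3
          push_cast at this ⊢
          simp only [SimpleGraph.Walk.length_cons, SimpleGraph.Walk.length_nil]
          push_cast
          linarith
      | cons h' q' =>
        simp only [SimpleGraph.Walk.length_cons] at hp
        omega

theorem exists_unique_b (N : ℕ) (hN : 1 ≤ N) (s : Fin (6 * N + N - 1) → Fin (6 * N))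
    (hs : Function.Surjective s) :
    ∃ v : Fin (6 * N), 5 * N ≤ (v : ℕ) ∧ ∀ j k, s j = v → s k = v → j = k := by
  classical
  by_contra hcon
  push Not at hcon
  have h1 : (Finset.univ : Finset (Fin (6 * N + N - 1))).card =
      ∑ v : Fin (6 * N), (Finset.univ.filter (fun j => s j = v)).card :=
    Finset.card_eq_sum_card_fiberwise (fun _ _ => Finset.mem_coe.2 (Finset.mem_univ _))
  have h2 : ∑ v : Fin (6 * N), (1 + if 5 * N ≤ (v : ℕ) then 1 else 0) ≤
      ∑ v : Fin (6 * N), (Finset.univ.filter (fun j => s j = v)).card := by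
    refine Finset.sum_le_sum fun v _ => ?_
    split_ifs with h
    · obtain ⟨j, k, hj, hk, hjk⟩ := hcon v h
      exact Finset.one_lt_card.2 ⟨j, by simp [hj], k, by simp [hk], hjk⟩
    · obtain ⟨j, hj⟩ := hs v
      exact Finset.card_pos.2 ⟨j, by simp [hj]⟩
  have h3 : ∑ v : Fin (6 * N), (if 5 * N ≤ (v : ℕ) then 1 else 0) = N := by
    rw [Fin.sum_univ_eq_sum_range (fun v => if 5 * N ≤ v then 1 else 0) (6 * N),
      ← Finset.sum_filter, Finset.sum_const, smul_eq_mul, mul_one]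
    have : (Finset.range (6 * N)).filter (fun v => 5 * N ≤ v) = Finset.Ico (5 * N) (6 * N) := by
      ext x; simp only [Finset.mem_filter, Finset.mem_range, Finset.mem_Ico]; omega
    rw [this, Nat.card_Ico]; omega
  rw [Finset.sum_add_distrib, h3, ← h1] at h2
  simp at h2
  omega

theorem uncoded_lower (N : ℕ) (hN : 1 ≤ N) (s : Fin (6 * N + N - 1) → Fin (6 * N))
    (hs : Function.Surjective s)
    (h : ∀ u v, (exGraphTwo N).Adj u v → ∃ j k, s j = u ∧ s k = v ∧
      (j : ℕ) ≤ k + 2 * N ∧ (k : ℕ) ≤ j + 2 * N) : False := by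
  classical
  obtain ⟨v, hv, huniq⟩ := exists_unique_b N hN s hs
  obtain ⟨q, hq⟩ := hs v
  have hv2 := v.2
  obtain ⟨i, hi⟩ : ∃ i, (v : ℕ) = 5 * N + i := ⟨v - 5 * N, by omega⟩
  let T : Finset ℕ := Finset.Ico (2 * i) (3 * N + 2 * i + 2) ∪ Finset.Ico (5 * N) (6 * N)
  have hT : T.card = 4 * N + 2 := by
    rw [Finset.card_union_of_disjoint, Nat.card_Ico, Nat.card_Ico]
    · omega
    · rw [Finset.disjoint_left]
      intro a ha hb
      rw [Finset.mem_Ico] at ha hb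
      omega
  have key : ∀ t ∈ T, ∃ j : Fin (6 * N + N - 1), (s j : ℕ) = t ∧
      (q : ℕ) ≤ j + 2 * N ∧ (j : ℕ) ≤ q + 2 * N := by
    intro t ht
    simp only [T, Finset.mem_union, Finset.mem_Ico] at ht
    by_cases htv : t = v
    · exact ⟨q, by rw [hq, htv], by omega, by omega⟩
    · have ht6 : t < 6 * N := by omega
      obtain ⟨j, k, hj, hk, h1, h2⟩ := h v ⟨t, ht6⟩ (by
        rw [exGraphTwo, SimpleGraph.fromRel_adj]
        refine ⟨fun e => htv (by rw [e]), Or.inl ?_⟩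
        by_cases h5 : t < 5 * N
        · exact Or.inr (Or.inl ⟨i + 1, by omega, by omega, by omega, by simp only []; omega,
            by simp only []; omega, h5⟩)
        · exact Or.inr (Or.inr ⟨hv, by simp only []; omega⟩))
      have : j = q := huniq j q hj hq
      subst this
      exact ⟨k, by rw [hk], h1, h2⟩
  have hne : Nonempty (Fin (6 * N + N - 1)) := ⟨q⟩
  choose! f hf using key
  have hle : T.card ≤ (Finset.Icc ((q : ℕ) - 2 * N) (q + 2 * N)).card := by
    apply Finset.card_le_card_of_injOn (fun t => (f t : ℕ))
    · intro t ht
      have := hf t ht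
      simp only [Finset.coe_Icc, Set.mem_Icc]
      omega
    · intro t ht t' ht' e
      have e' : f t = f t' := Fin.ext e
      rw [← (hf t ht).1, ← (hf t' ht').1, e']
  rw [hT, Nat.card_Icc] at hle
  omega

theorem uncoded_part (N : ℕ) (hN : 1 ≤ N) :
    (2 * (N : ℝ) + 1) / 2 < uncodedStretch (exGraphTwo N) 2 (6 * N + N - 1) := by
  have : (N : ℝ) + 1 ≤ uncodedStretch (exGraphTwo N) 2 (6 * N + N - 1) := by
    unfold uncodedStretch
    apply le_csInf
    · refine ⟨((6 * N + N - 1 : ℕ) : ℝ), fun j => if h : (j : ℕ) < 6 * N then ⟨j, h⟩ else ⟨0, by omega⟩, ?_, ?_⟩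
      · intro v
        refine ⟨⟨v, by omega⟩, ?_⟩
        simp
      · intro u v p _ _
        refine ⟨0, 6 * N + N - 2, by omega, by omega, ?_, ?_⟩
        · intro x _
          refine ⟨⟨x, by omega⟩, by omega, by simp only []; omega, ?_⟩
          simp
        · have e : 6 * N + N - 2 - 0 + 1 = 6 * N + N - 1 := by omega
          rw [e]
          have h0 : (0 : ℝ) ≤ ((6 * N + N - 1 : ℕ) : ℝ) := Nat.cast_nonneg _
          have h1 : (0 : ℝ) ≤ (p.length : ℝ) := Nat.cast_nonneg _
          nlinarith
    · rintro r ⟨s, hs, h⟩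
      by_contra hr
      push Not at hr
      refine uncoded_lower N hN s hs fun u v huv => ?_
      obtain ⟨a, b, hab, hb, hsup, hw⟩ := h u v huv.toWalk (by
        simp [SimpleGraph.Walk.cons_isPath_iff, huv.ne]) (by simp)
      obtain ⟨j, hj1, hj2, hj⟩ := hsup u (by simp)
      obtain ⟨k, hk1, hk2, hk⟩ := hsup v (by simp)
      refine ⟨j, k, hj, hk, ?_⟩
      have hlen : huv.toWalk.length = 1 := by simp
      rw [hlen] at hw
      have : ((b - a + 1 : ℕ) : ℝ) < ((2 * N + 2 : ℕ) : ℝ) := by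
        push_cast at hw ⊢
        linarith
      have := Nat.cast_lt.1 this
      omega
  linarith

/-- For the graph `H_N` on `n = 6N` vertices: every uncoded store with
`N−1` redundant chunks has stretch `> (2N+1)/2`, while some linearly coded store with a
single redundant chunk achieves stretch `≤ (2N+1)/2`. Hence uncoded stores need at least `N`
redundant chunks to match a coded store with one redundant chunk. -/
theorem statement_18 (N : ℕ) (hN : 1 ≤ N) :
    (2 * (N : ℝ) + 1) / 2 < uncodedStretch (exGraphTwo N) 2 (6 * N + N - 1) ∧
    linStretch (exGraphTwo N) 2 (6 * N + 1) ≤ (2 * (N : ℝ) + 1) / 2 := by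
  exact ⟨uncoded_part N hN, coded_part N hN⟩
end
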